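/- Let n ≥ 2, let K be a field, let C_n be the graph obtained from the ladder graph A_n by adjoining two new vertices y_{n+1}, y_{n+2} together with the edges {y_n,y_{n+1}} and {y_1,y_{n+2}}, and let S = K[V(C_n)]. Then depth(S/I(C_n)) = sdepth(S/I(C_n)) and this common value equals ⌈n/2⌉ + 1 if n ≡ 0 or 3 (mod 4), equals ⌈(n+1)/2⌉ if n ≡ 1 (mod 4), and equals ⌈(n+1)/2⌉ + 1 if n ≡ 2 (mod 4). -/

import Mathlib

open MvPolynomial

/-- The edge ideal of a simple graph `G`, inside `K[x_v : v ∈ V]`. -/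
noncomputable def edgeIdeal (K : Type*) [Field K] {V : Type*} (G : SimpleGraph V) :
    Ideal (MvPolynomial V K) :=
  Ideal.span {m | ∃ i j : V, G.Adj i j ∧ m = X i * X j}

/-- The graded maximal ideal of `K[x_v : v ∈ V]`. -/
noncomputable def maxIdeal (K : Type*) [Field K] (V : Type*) : Ideal (MvPolynomial V K) :=
  Ideal.span (Set.range (X : V → MvPolynomial V K))

/-- depth of `S/I` over `S = K[x_v]`: the supremum of lengths of regular sequences on `S/I`
consisting of elements of the graded maximal ideal. -/
noncomputable def depthQuot {K : Type*} [Field K] {V : Type*} (I : Ideal (MvPolynomial V K)) : ℕ :=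
  sSup {n : ℕ | ∃ rs : List (MvPolynomial V K), rs.length = n ∧
    (∀ r ∈ rs, r ∈ maxIdeal K V) ∧
    RingTheory.Sequence.IsRegular (MvPolynomial V K ⧸ I) rs}

/-- The Stanley space `u·K[Z]` inside `S/I`, as a `K`-subspace. -/
noncomputable def stanleySpace {K : Type*} [Field K] {V : Type*}
    (I : Ideal (MvPolynomial V K)) (u : V →₀ ℕ) (Z : Finset V) :
    Submodule K (MvPolynomial V K ⧸ I) :=
  Submodule.span K
    {x | ∃ a : V →₀ ℕ, a.support ⊆ Z ∧ x = Ideal.Quotient.mk I (monomial (u + a) (1 : K))}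

/-- A Stanley decomposition of `S/I`: a finite family of Stanley spaces `u_j K[Z_j]`,
each of which is a free `K[Z_j]`-module (expressed by linear independence of the monomial
spanning set), whose internal direct sum is all of `S/I`. -/
structure StanleyDecomposition {K : Type*} [Field K] {V : Type*}
    (I : Ideal (MvPolynomial V K)) : Type _ where
  m : ℕ
  u : Fin m → (V →₀ ℕ)
  Z : Fin m → Finset V
  free : ∀ j : Fin m, LinearIndependent K
    (fun a : {a : V →₀ ℕ // a.support ⊆ Z j} =>
      Ideal.Quotient.mk I (monomial (u j + (a : V →₀ ℕ)) (1 : K)))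
  internal : DirectSum.IsInternal (fun j : Fin m => stanleySpace I (u j) (Z j))

/-- The Stanley depth of `S/I`. -/
noncomputable def sdepthQuot {K : Type*} [Field K] {V : Type*}
    (I : Ideal (MvPolynomial V K)) : ℕ :=
  sSup {n : ℕ | ∃ D : StanleyDecomposition I, ∀ j, n ≤ (D.Z j).card}

/-- `pdimLE R n M`: the `R`-module `M` has projective dimension at most `n`,
i.e. it admits a projective resolution of length `n`. -/
def pdimLE (R : Type*) [CommRing R] :
    (n : ℕ) → (M : Type*) → [AddCommGroup M] → [Module R M] → Prop
  | 0, M, _, _ => Module.Projective R M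
  | (n+1), M, _, _ => ∃ (P : Type _) (_ : AddCommGroup P) (_ : Module R P)
      (f : P →ₗ[R] M), Module.Projective R P ∧ Function.Surjective f ∧
        pdimLE R n (LinearMap.ker f)

/-- The projective dimension of `S/I` over `S`: the length of a minimal (projective/free)
resolution, i.e. the least `n` such that `S/I` has a projective resolution of length `n`. -/
noncomputable def pdimQuot {K : Type*} [Field K] {V : Type*}
    (I : Ideal (MvPolynomial V K)) : ℕ :=
  sInf {n : ℕ | pdimLE (MvPolynomial V K) n (MvPolynomial V K ⧸ I)}

/-- The ladder graph `A n` on `2n` vertices: `inl i = x_{i+1}`, `inr i = y_{i+1}`. -/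
def graphA (n : ℕ) : SimpleGraph (Fin n ⊕ Fin n) :=
  SimpleGraph.fromRel (fun a b =>
    match a, b with
    | .inl i, .inl j => (i : ℕ) + 1 = j
    | .inr i, .inr j => (i : ℕ) + 1 = j
    | .inl i, .inr j => (i : ℕ) = (j : ℕ)
    | .inr _, .inl _ => False)

/-- The graph `B n`: the ladder `A n` with one extra vertex `y_{n+1}` and edge `{y_n, y_{n+1}}`.
Here `inl i = x_{i+1}` (`i < n`) and `inr i = y_{i+1}` (`i < n+1`). -/
def graphB (n : ℕ) : SimpleGraph (Fin n ⊕ Fin (n+1)) :=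
  SimpleGraph.fromRel (fun a b =>
    match a, b with
    | .inl i, .inl j => (i : ℕ) + 1 = j
    | .inr i, .inr j => (i : ℕ) + 1 = j
    | .inl i, .inr j => (i : ℕ) = (j : ℕ)
    | .inr _, .inl _ => False)

/-- The graph `C n`: the ladder `A n` with two extra vertices `y_{n+1}, y_{n+2}` and extra
edges `{y_n, y_{n+1}}` and `{y_1, y_{n+2}}`. Here `inl i = x_{i+1}` (`i < n`) and
`inr i = y_{i+1}` (`i < n+2`). -/
def graphC (n : ℕ) : SimpleGraph (Fin n ⊕ Fin (n+2)) :=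
  SimpleGraph.fromRel (fun a b =>
    match a, b with
    | .inl i, .inl j => (i : ℕ) + 1 = j
    | .inr i, .inr j => ((i : ℕ) + 1 = j ∧ (j : ℕ) ≤ n) ∨ ((i : ℕ) = 0 ∧ (j : ℕ) = n + 1)
    | .inl i, .inr j => (i : ℕ) = (j : ℕ)
    | .inr _, .inl _ => False)

/-- The graph `D n`: the ladder `A n` with two extra vertices `x_{n+1}, y_{n+1}` and extra
edges `{y_n, y_{n+1}}` and `{x_1, x_{n+1}}`. Here `inl i = x_{i+1}` and `inr i = y_{i+1}`
(`i < n+1`). -/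
def graphD (n : ℕ) : SimpleGraph (Fin (n+1) ⊕ Fin (n+1)) :=
  SimpleGraph.fromRel (fun a b =>
    match a, b with
    | .inl i, .inl j => ((i : ℕ) + 1 = j ∧ (j : ℕ) ≤ n - 1) ∨ ((i : ℕ) = 0 ∧ (j : ℕ) = n)
    | .inr i, .inr j => (i : ℕ) + 1 = j
    | .inl i, .inr j => (i : ℕ) = (j : ℕ) ∧ (i : ℕ) ≤ n - 1
    | .inr _, .inl _ => False)

/-- The circulant graph `C_q(s)` on vertex set `{x_1, …, x_q}` (realized as `Fin q`):
`x_i` and `x_j` are adjacent iff `|i - j| ∈ s` or `q - |i - j| ∈ s`. -/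
def circulantGraph (q : ℕ) (s : Set ℕ) : SimpleGraph (Fin q) :=
  SimpleGraph.fromRel (fun i j =>
    ((i : ℤ) - (j : ℤ)).natAbs ∈ s ∨ q - ((i : ℤ) - (j : ℤ)).natAbs ∈ s)


/-- Splitting trees for the induced subgraph on `W`. -/
inductive SplitTree {V : Type*} (G : SimpleGraph V) : ℕ → Set V → Prop
  | empty : SplitTree G 0 ∅
  | iso (d : ℕ) (W : Set V) (v : V) (hv : v ∈ W) (h : ∀ w ∈ W, ¬ G.Adj v w)
      (h1 : SplitTree G d (W \ {v})) : SplitTree G (d + 1) W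
  | split (d : ℕ) (W : Set V) (v : V) (hv : v ∈ W)
      (h1 : SplitTree G (d + 1) (W \ {v}))
      (h2 : SplitTree G d (W \ {w | w = v ∨ G.Adj v w})) : SplitTree G (d + 1) W
  | weak (d e : ℕ) (W : Set V) (hde : d ≤ e) (h : SplitTree G e W) : SplitTree G d W

/-- Greedy construction of a maximal independent set of `W` with `d` elements. -/
inductive Greedy {V : Type*} (G : SimpleGraph V) : ℕ → Set V → Prop
  | empty : Greedy G 0 ∅
  | step (d : ℕ) (W : Set V) (v : V) (hv : v ∈ W)
      (h : Greedy G d (W \ {w | w = v ∨ G.Adj v w})) : Greedy G (d + 1) W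

/-- The vertices `x_1..x_a`, `y_1..y_b` and `y_{n+2}`. -/
def ladderSet (n a b : ℕ) : Set (Fin n ⊕ Fin (n + 2)) :=
  {w | match w with
    | .inl i => (i : ℕ) < a
    | .inr i => (i : ℕ) < b ∨ (i : ℕ) = n + 1}

/-- Vertex `x_{i+1}`. -/
def vx {n : ℕ} (i : ℕ) (h : i < n) : Fin n ⊕ Fin (n + 2) := .inl ⟨i, h⟩

/-- Vertex `y_{i+1}`. -/
def vy {n : ℕ} (i : ℕ) (h : i < n + 2) : Fin n ⊕ Fin (n + 2) := .inr ⟨i, h⟩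

section ladder

variable {n : ℕ}

lemma ladderSet_ext {s t : Set (Fin n ⊕ Fin (n + 2))}
    (h1 : ∀ i (h : i < n), vx i h ∈ s ↔ vx i h ∈ t)
    (h2 : ∀ i (h : i < n + 2), vy i h ∈ s ↔ vy i h ∈ t) : s = t := by
  ext w
  rcases w with ⟨i, hi⟩ | ⟨i, hi⟩
  · exact h1 i hi
  · exact h2 i hi

@[simp] lemma mem_ladder_x {a b i : ℕ} (h : i < n) : vx i h ∈ ladderSet n a b ↔ i < a := Iff.rfl
@[simp] lemma mem_ladder_y {a b i : ℕ} (h : i < n + 2) :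
    vy i h ∈ ladderSet n a b ↔ (i < b ∨ i = n + 1) := Iff.rfl
@[simp] lemma vx_eq {i j : ℕ} (h : i < n) (h' : j < n) : vx i h = vx j h' ↔ i = j := by
  simp [vx]
@[simp] lemma vy_eq {i j : ℕ} (h : i < n + 2) (h' : j < n + 2) : vy i h = vy j h' ↔ i = j := by
  simp [vy]
@[simp] lemma vx_ne_vy {i j : ℕ} (h : i < n) (h' : j < n + 2) : vx i h ≠ vy j h' := by
  simp [vx, vy]
@[simp] lemma vy_ne_vx {i j : ℕ} (h : i < n) (h' : j < n + 2) : vy j h' ≠ vx i h := by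
  simp [vx, vy]
@[simp] lemma adj_xx {i j : ℕ} (h : i < n) (h' : j < n) :
    (graphC n).Adj (vx i h) (vx j h') ↔ (i + 1 = j ∨ j + 1 = i) := by
  simp only [graphC, vx, SimpleGraph.fromRel_adj, ne_eq, Sum.inl.injEq, Fin.mk.injEq]
  omega
@[simp] lemma adj_xy {i j : ℕ} (h : i < n) (h' : j < n + 2) :
    (graphC n).Adj (vx i h) (vy j h') ↔ i = j := by
  simp [graphC, vx, vy, SimpleGraph.fromRel_adj]
@[simp] lemma adj_yx {i j : ℕ} (h : i < n) (h' : j < n + 2) :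
    (graphC n).Adj (vy j h') (vx i h) ↔ i = j := by
  simp [graphC, vx, vy, SimpleGraph.fromRel_adj]
@[simp] lemma adj_yy {i j : ℕ} (h : i < n + 2) (h' : j < n + 2) :
    (graphC n).Adj (vy i h) (vy j h') ↔
      ((i + 1 = j ∧ j ≤ n) ∨ (i = 0 ∧ j = n + 1)) ∨ ((j + 1 = i ∧ i ≤ n) ∨ (j = 0 ∧ i = n + 1)) := by
  simp only [graphC, vy, SimpleGraph.fromRel_adj, ne_eq, Sum.inr.injEq, Fin.mk.injEq]
  omega

/-- Combined bookkeeping for the two families. -/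
lemma ladder_main (m : ℕ) :
    (m ≤ n → SplitTree (graphC n) (2 * ((m + 2) / 4) + 1) (ladderSet n m (m + 1)) ∧
      Greedy (graphC n) (2 * ((m + 2) / 4) + 1) (ladderSet n m (m + 1))) ∧
    (m + 1 ≤ n → SplitTree (graphC n) (2 * (m / 4) + 2) (ladderSet n (m + 1) m) ∧
      Greedy (graphC n) (2 * (m / 4) + 2) (ladderSet n (m + 1) m)) := by
  have hlast : n + 1 < n + 2 := by omega
  have e0 : (ladderSet n 0 0) \ {vy (n+1) hlast} = ∅ := by
    apply ladderSet_ext <;> intro i hi <;> simp <;> omega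
  have e0' : (ladderSet n 0 0) \ {w | w = vy (n+1) hlast ∨ (graphC n).Adj (vy (n+1) hlast) w} = ∅ := by
    apply ladderSet_ext <;> intro i hi <;> simp <;> omega
  have T0 : SplitTree (graphC n) 1 (ladderSet n 0 0) := by
    refine .iso 0 _ (vy (n+1) hlast) (by simp) ?_ (by rw [e0]; exact .empty)
    rintro (⟨i, hi⟩ | ⟨i, hi⟩) hw
    · change vx i hi ∈ _ at hw
      simp at hw
    · change vy i hi ∈ _ at hw
      change ¬ (graphC n).Adj _ (vy i hi)
      simp at hw ⊢
      omega
  have U0 : Greedy (graphC n) 1 (ladderSet n 0 0) :=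
    .step 0 _ (vy (n+1) hlast) (by simp) (by rw [e0']; exact .empty)
  induction m using Nat.strong_induction_on with
  | _ m ih =>
  constructor
  · intro hm
    rcases m with _ | _ | k
    · -- an edge
      have ea : ladderSet n 0 (0+1) \ {vy 0 (by omega)} = ladderSet n 0 0 := by
        apply ladderSet_ext <;> intro i hi <;> simp <;> omega
      have eb : ladderSet n 0 (0+1) \ {w | w = vy 0 (by omega) ∨ (graphC n).Adj (vy 0 (by omega)) w}
          = ∅ := by
        apply ladderSet_ext <;> intro i hi <;> simp <;> omega
      exact ⟨.split 0 _ (vy 0 (by omega)) (by simp) (by rw [ea]; exact T0)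
        (by rw [eb]; exact .empty), .step 0 _ (vy 0 (by omega)) (by simp) (by rw [eb]; exact .empty)⟩
    · have ea : ((ladderSet n (0+1) (0+1+1) \ {vy 0 (by omega)}) \ {vx 0 (by omega)}) \ {vy 1 (by omega)}
          = ladderSet n 0 0 := by
        apply ladderSet_ext <;> intro i hi <;> simp <;> omega
      have eb : ladderSet n (0+1) (0+1+1) \
          {w | w = vy 0 (by omega) ∨ (graphC n).Adj (vy 0 (by omega)) w} = ∅ := by
        apply ladderSet_ext <;> intro i hi <;> simp <;> omega
      refine ⟨.split 0 _ (vy 0 (by omega)) (by simp) ?_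
        (by rw [eb]; exact .empty), .step 0 _ (vy 0 (by omega)) (by simp) (by rw [eb]; exact .empty)⟩
      refine .weak 1 3 _ (by norm_num) ?_
      refine .iso 2 _ (vx 0 (by omega)) (by simp) ?_ ?_
      · rintro (⟨i, hi⟩ | ⟨i, hi⟩) hw
        · change vx i hi ∈ _ at hw
          change ¬ (graphC n).Adj _ (vx i hi)
          simp at hw ⊢
          omega
        · change vy i hi ∈ _ at hw
          change ¬ (graphC n).Adj _ (vy i hi)
          simp at hw ⊢
          omega
      refine .iso 1 _ (vy 1 (by omega)) (by simp) ?_ (by rw [ea]; exact T0)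
      · rintro (⟨i, hi⟩ | ⟨i, hi⟩) hw
        · change vx i hi ∈ _ at hw
          change ¬ (graphC n).Adj _ (vx i hi)
          simp at hw ⊢
        · change vy i hi ∈ _ at hw
          change ¬ (graphC n).Adj _ (vy i hi)
          simp at hw ⊢
          omega
    · have ea : (ladderSet n (k+1+1) (k+1+1+1) \ {vy (k+1) (by omega)}) \ {vy (k+2) (by omega)}
          = ladderSet n (k+1+1) (k+1) := by
        apply ladderSet_ext <;> intro i hi <;> simp <;> omega
      have eb : ladderSet n (k+1+1) (k+1+1+1) \
          {w | w = vy (k+1) (by omega) ∨ (graphC n).Adj (vy (k+1) (by omega)) w}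
            = ladderSet n (k+1) k := by
        apply ladderSet_ext <;> intro i hi <;> simp <;> omega
      obtain ⟨t1, -⟩ := (ih (k+1) (by omega)).2 (by omega)
      obtain ⟨t2, u2⟩ := (ih k (by omega)).2 (by omega)
      have e : 2 * ((k + 1 + 1 + 2) / 4) + 1 = 2 * (k / 4) + 2 + 1 := by omega
      rw [e]
      refine ⟨.split _ _ (vy (k+1) (by omega)) (by simp) ?_ (by rw [eb]; exact t2),
        .step _ _ (vy (k+1) (by omega)) (by simp) (by rw [eb]; exact u2)⟩
      refine .iso _ _ (vy (k+2) (by omega)) (by simp) ?_ (by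
        rw [ea]; exact .weak _ _ _ (by omega) t1)
      rintro (⟨i, hi⟩ | ⟨i, hi⟩) hw
      · change vx i hi ∈ _ at hw
        change ¬ (graphC n).Adj _ (vx i hi)
        simp at hw ⊢
        omega
      · change vy i hi ∈ _ at hw
        change ¬ (graphC n).Adj _ (vy i hi)
        simp at hw ⊢
        omega
  · intro hm
    rcases m with _ | k
    · have ea : ladderSet n (0+1) 0 \ {vx 0 (by omega)} = ladderSet n 0 0 := by
        apply ladderSet_ext <;> intro i hi <;> simp <;> omega
      have eb : ladderSet n (0+1) 0 \ {w | w = vx 0 (by omega) ∨ (graphC n).Adj (vx 0 (by omega)) w}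
          = ladderSet n 0 0 := by
        apply ladderSet_ext <;> intro i hi <;> simp <;> omega
      refine ⟨.iso 1 _ (vx 0 (by omega)) (by simp) ?_ (by rw [ea]; exact T0),
        .step 1 _ (vx 0 (by omega)) (by simp) (by rw [eb]; exact U0)⟩
      rintro (⟨i, hi⟩ | ⟨i, hi⟩) hw
      · change vx i hi ∈ _ at hw
        change ¬ (graphC n).Adj _ (vx i hi)
        simp at hw ⊢
        omega
      · change vy i hi ∈ _ at hw
        change ¬ (graphC n).Adj _ (vy i hi)
        simp at hw ⊢
        omega
    · have ea : (ladderSet n (k+1+1) (k+1) \ {vx k (by omega)}) \ {vx (k+1) (by omega)}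
          = ladderSet n k (k+1) := by
        apply ladderSet_ext <;> intro i hi <;> simp <;> omega
      have eb : ladderSet n (k+1+1) (k+1) \
          {w | w = vx k (by omega) ∨ (graphC n).Adj (vx k (by omega)) w}
            = ladderSet n (k-1) k := by
        apply ladderSet_ext <;> intro i hi <;> simp <;> omega
      obtain ⟨t1, -⟩ := (ih k (by omega)).1 (by omega)
      have h2 : SplitTree (graphC n) (2 * ((k + 1) / 4) + 1) (ladderSet n (k - 1) k) ∧
          Greedy (graphC n) (2 * ((k + 1) / 4) + 1) (ladderSet n (k - 1) k) := by
        rcases k with _ | k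
        · exact ⟨T0, U0⟩
        · exact (ih k (by omega)).1 (by omega)
      refine ⟨.split _ _ (vx k (by omega)) (by simp) ?_ (by rw [eb]; exact h2.1),
        .step _ _ (vx k (by omega)) (by simp) (by rw [eb]; exact h2.2)⟩
      refine .iso _ _ (vx (k+1) (by omega)) (by simp) ?_ (by
        rw [ea]; exact .weak _ _ _ (by omega) t1)
      rintro (⟨i, hi⟩ | ⟨i, hi⟩) hw
      · change vx i hi ∈ _ at hw
        change ¬ (graphC n).Adj _ (vx i hi)
        simp at hw ⊢
        omega
      · change vy i hi ∈ _ at hw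
        change ¬ (graphC n).Adj _ (vy i hi)
        simp at hw ⊢
        omega

lemma ladder_univ : ladderSet n n (n + 1) = Set.univ := by
  apply ladderSet_ext <;> intro i hi <;> simp <;> omega

end ladder

section depthUpper

open RingTheory.Sequence
open scoped Pointwise

variable {R : Type*} [CommRing R] [IsNoetherianRing R]

lemma exists_assoc_between {M : Type*} [AddCommGroup M] [Module R M] (m : Ideal R) [m.IsPrime]
    (y : M) (hy : ∀ s : R, s • y = 0 → s ∈ m) :
    ∃ P ∈ associatedPrimes R M, P ≤ m ∧ ∀ s : R, s • y = 0 → s ∈ P := by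
  have hann : Module.annihilator R (Submodule.span R {y}) ≤ m := by
    intro s hs
    rw [Module.mem_annihilator] at hs
    apply hy
    have := hs ⟨y, Submodule.mem_span_singleton_self y⟩
    simpa [Subtype.ext_iff] using this
  obtain ⟨P, hP, hPm⟩ := Ideal.exists_minimalPrimes_le hann
  refine ⟨P, ?_, hPm, ?_⟩
  · have h1 := Module.associatedPrimes.minimalPrimes_annihilator_subset_associatedPrimes R _ hP
    exact associatedPrimes.subset_of_injective (f := (Submodule.span R {y}).subtype)
      (Submodule.subtype_injective _) h1
  · intro s hs
    apply hP.1.2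
    rw [Module.mem_annihilator]
    rintro ⟨z, hz⟩
    obtain ⟨a, rfl⟩ := Submodule.mem_span_singleton.1 hz
    ext
    simp [smul_comm s a, hs]

lemma mem_of_eval_monic (m : Ideal R) [m.IsPrime] (p : Polynomial R) (hp : p.Monic)
    (hc : ∀ k, k < p.natDegree → p.coeff k ∈ m) (s : R) (hs : p.eval s ∈ m) : s ∈ m := by
  have h1 : p.map (Ideal.Quotient.mk m) = Polynomial.X ^ p.natDegree := by
    ext k
    rw [Polynomial.coeff_map, Polynomial.coeff_X_pow]
    split_ifs with h
    · rw [h, hp.coeff_natDegree, map_one]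
    · rcases lt_or_gt_of_ne h with h | h
      · exact Ideal.Quotient.eq_zero_iff_mem.2 (hc k h)
      · rw [Polynomial.coeff_eq_zero_of_natDegree_lt h, map_zero]
  have h2 : Ideal.Quotient.mk m (p.eval s) = 0 := Ideal.Quotient.eq_zero_iff_mem.2 hs
  rw [← Polynomial.eval_map_apply, h1, Polynomial.eval_pow, Polynomial.eval_X, ← map_pow,
    Ideal.Quotient.eq_zero_iff_mem] at h2
  exact Ideal.IsPrime.mem_of_pow_mem inferInstance _ h2

lemma assoc_step {M : Type*} [AddCommGroup M] [Module R M] [Module.Finite R M]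
    (m : Ideal R) [m.IsPrime] (r : R) (hr : r ∈ m) (hreg : IsSMulRegular M r)
    (P : Ideal R) (hP : P ∈ associatedPrimes R M) (hPm : P ≤ m) :
    ∃ Q ∈ associatedPrimes R (QuotSMulTop r M), P ≤ Q ∧ Q ≤ m ∧ r ∈ Q ∧ r ∉ P := by
  obtain ⟨hPp, x, hx⟩ := isAssociatedPrime_iff.1 hP
  have hx' : ∀ s : R, s ∈ P ↔ s • x = 0 := by
    intro s
    rw [hx]
    simp [Submodule.mem_colon_singleton]
  let N : Submodule R M :=
    { carrier := {y | ∀ p ∈ P, p • y = 0}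
      add_mem' := by
        intro a b ha hb p hp
        rw [smul_add, ha p hp, hb p hp, add_zero]
      zero_mem' := by intro p _; simp
      smul_mem' := by
        intro c a ha p hp
        rw [smul_comm, ha p hp, smul_zero] }
  have hxN : x ∈ N := fun p hp => (hx' p).1 hp
  have key : ∃ y ∈ N, ∀ s : R, s • y ∈ r • (⊤ : Submodule R M) → s ∈ m := by
    by_contra hcon
    push Not at hcon
    have hall : ∀ N' : Submodule R M, N'.FG → N' ≤ N → ∃ s, s ∉ m ∧ ∀ y ∈ N',
        s • y ∈ r • (⊤ : Submodule R M) := by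
      intro N' hN'
      induction N', hN' using Submodule.fg_induction with
      | singleton z =>
        intro hle
        obtain ⟨s, hs, hsm⟩ := hcon z (hle (Submodule.mem_span_singleton_self z))
        refine ⟨s, hsm, ?_⟩
        intro y hy
        obtain ⟨a, rfl⟩ := Submodule.mem_span_singleton.1 hy
        rw [smul_comm]
        exact Submodule.smul_mem _ _ hs
      | sup M1 M2 _ _ h1 h2 =>
        intro hle
        obtain ⟨s1, hs1, h1⟩ := h1 (le_sup_left.trans hle)
        obtain ⟨s2, hs2, h2⟩ := h2 (le_sup_right.trans hle)
        refine ⟨s1 * s2, fun h => (Ideal.IsPrime.mem_or_mem inferInstance h).elim hs1 hs2, ?_⟩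
        intro y hy
        obtain ⟨a, ha, b, hb, rfl⟩ := Submodule.mem_sup.1 hy
        rw [smul_add]
        refine Submodule.add_mem _ ?_ ?_
        · rw [mul_comm, mul_smul]
          exact Submodule.smul_mem _ _ (h1 a ha)
        · rw [mul_smul]
          exact Submodule.smul_mem _ _ (h2 b hb)
    obtain ⟨s, hs, hsN⟩ := hall N (IsNoetherian.noetherian N) le_rfl
    let f : Module.End R N := algebraMap R (Module.End R N) s
    have hrange : LinearMap.range f ≤ (Ideal.span {r}) • (⊤ : Submodule R N) := by
      rintro _ ⟨⟨y, hy⟩, rfl⟩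
      obtain ⟨z, -, hz⟩ := (Submodule.mem_smul_pointwise_iff_exists _ _ _).1 (hsN y hy)
      have hzN : z ∈ N := by
        intro p hp
        apply hreg
        change r • p • z = r • (0 : M)
        rw [smul_comm, hz, smul_comm, hy p hp, smul_zero, smul_zero]
      have : f ⟨y, hy⟩ = r • (⟨z, hzN⟩ : N) := by
        ext
        simp [f, hz]
      rw [this]
      exact Submodule.smul_mem_smul (Ideal.mem_span_singleton_self r) trivial
    obtain ⟨p, hp, -, hcoef, hz⟩ :=
      LinearMap.exists_monic_and_natDegree_eq_and_coeff_mem_pow_and_aeval_eq_zero R f _ hrange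
    have hspan : Ideal.span {r} ≤ m := (Ideal.span_singleton_le_iff_mem m).2 hr
    apply hs
    apply mem_of_eval_monic m p hp
    · intro k hk
      exact hspan (Ideal.pow_le_self (by omega) (hcoef k))
    · apply hPm
      rw [hx']
      rw [Polynomial.aeval_algebraMap_apply_eq_algebraMap_eval] at hz
      have := LinearMap.congr_fun hz ⟨x, hxN⟩
      simpa [Subtype.ext_iff] using this
  obtain ⟨y, hyN, hy⟩ := key
  let q : QuotSMulTop r M := Submodule.Quotient.mk y
  have hq : ∀ s : R, s • q = 0 ↔ s • y ∈ r • (⊤ : Submodule R M) := by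
    intro s
    rw [← Submodule.Quotient.mk_smul, Submodule.Quotient.mk_eq_zero]
  obtain ⟨Q, hQ, hQm, hQs⟩ := exists_assoc_between m q (fun s hs => hy s ((hq s).1 hs))
  refine ⟨Q, hQ, ?_, hQm, ?_, ?_⟩
  · intro p hp
    apply hQs
    rw [hq, hyN p hp]
    exact Submodule.zero_mem _
  · apply hQs
    rw [hq]
    exact Submodule.smul_mem_pointwise_smul _ _ _ trivial
  · intro hrP
    rw [hx'] at hrP
    have : x = 0 := hreg (by simpa using hrP)
    exact hPp.ne_top ((Ideal.eq_top_iff_one P).2 ((hx' 1).2 (by simp [this])))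

lemma length_le_dim (m : Ideal R) [m.IsPrime] (rs : List R) :
    ∀ {M : Type*} [AddCommGroup M] [Module R M] [Module.Finite R M], (∀ r ∈ rs, r ∈ m) →
    IsWeaklyRegular M rs → ∀ P ∈ associatedPrimes R M, P ≤ m →
    ((rs.length : ℕ) : WithBot ℕ∞) ≤ ringKrullDim (R ⧸ P) := by
  induction rs with
  | nil =>
    intro M _ _ _ _ _ P hP _
    have : P.IsPrime := hP.1
    simpa using ringKrullDim_nonneg_of_nontrivial
  | cons r rs ih =>
    intro M _ _ _ hmem hreg P hP hPm
    rw [isWeaklyRegular_cons_iff] at hreg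
    obtain ⟨Q, hQ, hPQ, hQm, hrQ, hrP⟩ := assoc_step m r (hmem r (by simp)) hreg.1 P hP hPm
    have h1 := ih (fun s hs => hmem s (by simp [hs])) hreg.2 Q hQ hQm
    have : P.IsPrime := hP.1
    have h2 : ringKrullDim (R ⧸ Q) + 1 ≤ ringKrullDim (R ⧸ P) := by
      refine ringKrullDim_succ_le_of_surjective (Ideal.Quotient.factor hPQ)
        (Ideal.Quotient.factor_surjective hPQ) (r := Ideal.Quotient.mk P r) ?_ ?_
      · rw [mem_nonZeroDivisors_iff_ne_zero]
        rwa [Ne, Ideal.Quotient.eq_zero_iff_mem]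
      · rw [Ideal.Quotient.factor_mk]
        exact Ideal.Quotient.eq_zero_iff_mem.2 hrQ
    refine le_trans ?_ h2
    rw [List.length_cons, Nat.cast_add, Nat.cast_one]
    gcongr

end depthUpper

section stanleyReisner

variable {V : Type} (K : Type*) [Field K]

/-- The Stanley-Reisner ideal of a simplicial complex, described by coefficients. -/
def srIdeal (p : LowerSet (Finset V)) : Ideal (MvPolynomial V K) where
  carrier := {f | ∀ m : V →₀ ℕ, m.support ∈ p → coeff m f = 0}
  add_mem' := by
    intro f g hf hg m hm
    rw [coeff_add, hf m hm, hg m hm, add_zero]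
  zero_mem' := by intro m _; simp
  smul_mem' := by
    classical
    intro c f hf m hm
    rw [smul_eq_mul, coeff_mul]
    apply Finset.sum_eq_zero
    rintro ⟨a, b⟩ hab
    have hab' : a + b = m := by simpa using hab
    have : b.support ⊆ m.support := by
      intro i hi
      rw [← hab']
      simp only [Finsupp.mem_support_iff, Finsupp.add_apply] at hi ⊢
      omega
    rw [hf b (p.lower this hm), mul_zero]

lemma mem_srIdeal {p : LowerSet (Finset V)} {f : MvPolynomial V K} :
    f ∈ srIdeal K p ↔ ∀ m : V →₀ ℕ, m.support ∈ p → coeff m f = 0 := Iff.rfl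

/-- Deletion of a vertex. -/
def delC (v : V) (p : LowerSet (Finset V)) : LowerSet (Finset V) where
  carrier := {s | s ∈ p ∧ v ∉ s}
  lower' := fun _ _ hab ha => ⟨p.lower hab ha.1, fun h => ha.2 (hab h)⟩

/-- Star of a vertex. -/
def starC [DecidableEq V] (v : V) (p : LowerSet (Finset V)) : LowerSet (Finset V) where
  carrier := {s | insert v s ∈ p}
  lower' := fun _ _ hab ha => p.lower (Finset.insert_subset_insert v hab) ha

lemma mem_delC {v : V} {p : LowerSet (Finset V)} {s : Finset V} :
    s ∈ delC v p ↔ s ∈ p ∧ v ∉ s := Iff.rfl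

variable [DecidableEq V]

lemma mem_starC {v : V} {p : LowerSet (Finset V)} {s : Finset V} :
    s ∈ starC v p ↔ insert v s ∈ p := Iff.rfl

lemma X_mul_mem_srIdeal {v : V} {p : LowerSet (Finset V)} {f : MvPolynomial V K} :
    X v * f ∈ srIdeal K p ↔ f ∈ srIdeal K (starC v p) := by
  constructor
  · intro h m hm
    have h1 := h (Finsupp.single v 1 + m) (by
      refine p.lower ?_ hm
      intro i hi
      simp only [Finsupp.mem_support_iff, Finsupp.add_apply, Finset.mem_insert] at hi ⊢
      by_cases h : i = v
      · exact Or.inl h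
      · right
        rw [Finsupp.single_apply, if_neg (Ne.symm h)] at hi
        simpa using hi)
    rwa [coeff_X_mul] at h1
  · intro h m hm
    rw [coeff_X_mul']
    split_ifs with hv
    · apply h
      refine p.lower ?_ hm
      intro i hi
      rcases Finset.mem_insert.1 hi with rfl | hi
      · exact hv
      · simp only [Finsupp.mem_support_iff, Finsupp.tsub_apply] at hi ⊢
        omega
    · rfl

lemma srIdeal_mono {p q : LowerSet (Finset V)} (h : ∀ s, s ∈ q → s ∈ p) :
    srIdeal K p ≤ srIdeal K q := fun _ hf m hm => hf m (h _ hm)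

lemma srIdeal_le_del (v : V) (p : LowerSet (Finset V)) : srIdeal K p ≤ srIdeal K (delC v p) :=
  srIdeal_mono K fun _ hs => hs.1

lemma X_mul_mem_del (v : V) (p : LowerSet (Finset V)) (f : MvPolynomial V K) :
    X v * f ∈ srIdeal K (delC v p) := by
  intro m hm
  rw [coeff_X_mul', if_neg hm.2]

lemma exists_of_mem_del (v : V) (p : LowerSet (Finset V)) (f : MvPolynomial V K)
    (hf : f ∈ srIdeal K (delC v p)) : ∃ h, f - X v * h ∈ srIdeal K p := by
  refine ⟨divMonomial f (Finsupp.single v 1), ?_⟩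
  have : f - X v * divMonomial f (Finsupp.single v 1) = modMonomial f (Finsupp.single v 1) := by
    rw [sub_eq_iff_eq_add, modMonomial_add_divMonomial_single]
  rw [this]
  intro m hm
  by_cases hle : Finsupp.single v 1 ≤ m
  · exact coeff_modMonomial_of_le _ hle
  · rw [coeff_modMonomial_of_not_le _ hle]
    refine hf m ⟨hm, fun hv => hle ?_⟩
    rw [Finsupp.single_le_iff]
    exact Nat.one_le_iff_ne_zero.2 (Finsupp.mem_support_iff.1 hv)

lemma mem_maxIdeal {f : MvPolynomial V K} : f ∈ maxIdeal K V ↔ coeff 0 f = 0 := by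
  rw [maxIdeal, ← Set.image_univ, mem_ideal_span_X_image]
  constructor
  · intro h
    by_contra h0
    obtain ⟨i, -, hi⟩ := h 0 (mem_support_iff.2 h0)
    exact hi rfl
  · intro h m hm
    by_contra hcon
    push Not at hcon
    have : m = 0 := by
      ext i
      exact hcon i trivial
    rw [this] at hm
    exact mem_support_iff.1 hm h

lemma maxIdeal_eq_ker : maxIdeal K V = RingHom.ker (constantCoeff : MvPolynomial V K →+* K) := by
  ext f
  rw [mem_maxIdeal, RingHom.mem_ker, constantCoeff_eq]

instance : (maxIdeal K V).IsPrime := by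
  rw [maxIdeal_eq_ker]
  exact RingHom.ker_isPrime _

lemma srIdeal_le_max {p : LowerSet (Finset V)} (hp : ∅ ∈ p) : srIdeal K p ≤ maxIdeal K V := by
  intro f hf
  rw [mem_maxIdeal]
  exact hf 0 (by simpa using hp)

lemma max_smul_lt {I : Ideal (MvPolynomial V K)} (hI : I ≤ maxIdeal K V) :
    maxIdeal K V • (⊤ : Submodule (MvPolynomial V K) (MvPolynomial V K ⧸ I)) < ⊤ := by
  rw [lt_top_iff_ne_top]
  intro h
  have h1 : (Ideal.Quotient.mk I 1) ∈
      maxIdeal K V • (⊤ : Submodule (MvPolynomial V K) (MvPolynomial V K ⧸ I)) := by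
    rw [h]; trivial
  have h2 : maxIdeal K V • (⊤ : Submodule (MvPolynomial V K) (MvPolynomial V K ⧸ I)) ≤
      Submodule.map I.mkQ (maxIdeal K V) := by
    rw [Submodule.smul_le]
    rintro r hr n -
    obtain ⟨f, rfl⟩ := Ideal.Quotient.mk_surjective n
    exact ⟨r * f, Ideal.mul_mem_right _ _ hr, rfl⟩
  obtain ⟨f, hf, hfe⟩ := h2 h1
  have h3 : f - 1 ∈ I := Ideal.Quotient.eq.1 hfe
  have h4 : (1 : MvPolynomial V K) ∈ maxIdeal K V := by
    have := (maxIdeal K V).sub_mem hf (hI h3)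
    simpa using this
  rw [mem_maxIdeal] at h4
  simp at h4

/-- `S/I_p` has a regular sequence of length `d` in the maximal ideal. -/
def HasDepth (p : LowerSet (Finset V)) (d : ℕ) : Prop :=
  ∃ rs : List (MvPolynomial V K), rs.length = d ∧ (∀ r ∈ rs, r ∈ maxIdeal K V) ∧
    RingTheory.Sequence.IsRegular (MvPolynomial V K ⧸ srIdeal K p) rs

/-- Multiplication by a variable as a map of quotients. -/
noncomputable def mulMap (v : V) (p : LowerSet (Finset V)) :
    (MvPolynomial V K ⧸ srIdeal K (starC v p)) →ₗ[MvPolynomial V K]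
      (MvPolynomial V K ⧸ srIdeal K p) :=
  Submodule.mapQ _ _ (LinearMap.mulLeft (MvPolynomial V K) (X v)) (by
    intro f hf
    exact (X_mul_mem_srIdeal K).2 hf)

/-- The projection to the deletion. -/
noncomputable def projMap (v : V) (p : LowerSet (Finset V)) :
    (MvPolynomial V K ⧸ srIdeal K p) →ₗ[MvPolynomial V K]
      (MvPolynomial V K ⧸ srIdeal K (delC v p)) :=
  Submodule.mapQ _ _ LinearMap.id (srIdeal_le_del K v p)

lemma mulMap_mk (v : V) (p : LowerSet (Finset V)) (f : MvPolynomial V K) :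
    mulMap K v p (Ideal.Quotient.mk _ f) = Ideal.Quotient.mk _ (X v * f) := rfl

lemma projMap_mk (v : V) (p : LowerSet (Finset V)) (f : MvPolynomial V K) :
    projMap K v p (Ideal.Quotient.mk _ f) = Ideal.Quotient.mk _ f := rfl

lemma mulMap_injective (v : V) (p : LowerSet (Finset V)) : Function.Injective (mulMap K v p) := by
  rw [injective_iff_map_eq_zero]
  intro a ha
  obtain ⟨f, rfl⟩ := Ideal.Quotient.mk_surjective a
  rw [mulMap_mk, Ideal.Quotient.eq_zero_iff_mem] at ha
  exact Ideal.Quotient.eq_zero_iff_mem.2 ((X_mul_mem_srIdeal K).1 ha)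

lemma projMap_surjective (v : V) (p : LowerSet (Finset V)) :
    Function.Surjective (projMap K v p) := by
  intro a
  obtain ⟨f, rfl⟩ := Ideal.Quotient.mk_surjective a
  exact ⟨Ideal.Quotient.mk _ f, rfl⟩

lemma mul_proj_exact (v : V) (p : LowerSet (Finset V)) :
    Function.Exact (mulMap K v p) (projMap K v p) := by
  intro a
  obtain ⟨f, rfl⟩ := Ideal.Quotient.mk_surjective a
  rw [projMap_mk, Ideal.Quotient.eq_zero_iff_mem]
  constructor
  · intro hf
    obtain ⟨h, hh⟩ := exists_of_mem_del K v p f hf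
    refine ⟨Ideal.Quotient.mk _ h, ?_⟩
    rw [mulMap_mk]
    exact (Ideal.Quotient.eq.2 hh).symm
  · rintro ⟨b, hb⟩
    obtain ⟨h, rfl⟩ := Ideal.Quotient.mk_surjective b
    rw [mulMap_mk] at hb
    have := srIdeal_le_del K v p (Ideal.Quotient.eq.1 hb)
    have h2 := Ideal.sub_mem _ (X_mul_mem_del K v p h) this
    simpa using h2

end stanleyReisner

section depthLower

open CategoryTheory Abelian RingTheory.Sequence
open scoped Pointwise

universe u

variable {V : Type} [DecidableEq V] [Finite V] (K : Type u) [Field K]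

lemma hasDepth_iff {p : LowerSet (Finset V)} (hp : ∅ ∈ p) (d : ℕ) :
    HasDepth K p d ↔ ∀ i < d, Subsingleton (Ext
      (ModuleCat.of (MvPolynomial V K) (Shrink.{u} (MvPolynomial V K ⧸ maxIdeal K V)))
      (ModuleCat.of (MvPolynomial V K) (MvPolynomial V K ⧸ srIdeal K p)) i) :=
  ((ModuleCat.exists_isRegular_tfae (maxIdeal K V) d
    (ModuleCat.of (MvPolynomial V K) (MvPolynomial V K ⧸ srIdeal K p))
    (max_smul_lt K (srIdeal_le_max K hp))).out 1 3).symm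

lemma HasDepth.mono {p : LowerSet (Finset V)} (hp : ∅ ∈ p) {d e : ℕ} (hde : d ≤ e)
    (h : HasDepth K p e) : HasDepth K p d := by
  rw [hasDepth_iff K hp] at h ⊢
  exact fun i hi => h i (hi.trans_le hde)

lemma HasDepth.split {p : LowerSet (Finset V)} {v : V} (hv : {v} ∈ p) {d : ℕ}
    (h1 : HasDepth K (delC v p) d) (h2 : HasDepth K (starC v p) d) : HasDepth K p d := by
  have hp : ∅ ∈ p := p.lower (Finset.empty_subset _) hv
  rw [hasDepth_iff K hp]
  rw [hasDepth_iff K (show ∅ ∈ delC v p from ⟨hp, by simp⟩)] at h1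
  rw [hasDepth_iff K (show ∅ ∈ starC v p by simpa [mem_starC] using hv)] at h2
  intro i hi
  have hex := mul_proj_exact K v p
  let S : ShortComplex (ModuleCat (MvPolynomial V K)) :=
    ModuleCat.shortComplexOfCompEqZero (mulMap K v p) (projMap K v p) hex.linearMap_comp_eq_zero
  have hS : S.ShortExact :=
    { exact := ModuleCat.shortComplex_exact _ hex
      mono_f := (ModuleCat.mono_iff_injective _).2 (mulMap_injective K v p)
      epi_g := (ModuleCat.epi_iff_surjective _).2 (projMap_surjective K v p) }
  have zero1 := AddCommGrpCat.isZero_of_iff_subsingleton.mpr (h2 i hi)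
  have zero2 := AddCommGrpCat.isZero_of_iff_subsingleton.mpr (h1 i hi)
  exact AddCommGrpCat.subsingleton_of_isZero <| ShortComplex.Exact.isZero_of_both_zeros
    (Ext.covariant_sequence_exact₂'
      (ModuleCat.of (MvPolynomial V K) (Shrink.{u} (MvPolynomial V K ⧸ maxIdeal K V))) hS i)
    (zero1.eq_zero_of_src _) (zero2.eq_zero_of_tgt _)

lemma HasDepth.cone {p : LowerSet (Finset V)} {v : V} (hv : starC v p = p) {d : ℕ}
    (h1 : HasDepth K (delC v p) d) : HasDepth K p (d + 1) := by
  obtain ⟨rs, hl, hm, hreg⟩ := h1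
  refine ⟨X v :: rs, by simp [hl], ?_, ?_⟩
  · intro r hr
    rcases List.mem_cons.1 hr with rfl | hr
    · exact Ideal.subset_span ⟨v, rfl⟩
    · exact hm r hr
  rw [isRegular_cons_iff]
  constructor
  · intro a b hab
    obtain ⟨f, rfl⟩ := Ideal.Quotient.mk_surjective a
    obtain ⟨g, rfl⟩ := Ideal.Quotient.mk_surjective b
    have h2 : X v * f - X v * g ∈ srIdeal K p := Ideal.Quotient.eq.1 hab
    rw [← mul_sub, X_mul_mem_srIdeal, hv] at h2
    exact Ideal.Quotient.eq.2 h2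
  · have hk : (X v : MvPolynomial V K) •
        (⊤ : Submodule (MvPolynomial V K) (MvPolynomial V K ⧸ srIdeal K p)) =
        LinearMap.ker (projMap K v p) := by
      ext a
      rw [LinearMap.mem_ker, mul_proj_exact K v p a, Submodule.mem_smul_pointwise_iff_exists]
      constructor
      · rintro ⟨b, -, rfl⟩
        obtain ⟨g, rfl⟩ := Ideal.Quotient.mk_surjective b
        exact ⟨Ideal.Quotient.mk _ g, rfl⟩
      · rintro ⟨b, rfl⟩
        obtain ⟨g, rfl⟩ := Ideal.Quotient.mk_surjective b
        exact ⟨Ideal.Quotient.mk _ g, trivial, rfl⟩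
    exact (LinearEquiv.isRegular_congr ((Submodule.quotEquivOfEq _ _ hk).trans
      ((projMap K v p).quotKerEquivOfSurjective (projMap_surjective K v p))) rs).2 hreg

end depthLower

section complexes

variable {V : Type} [DecidableEq V]

/-- Join of the simplex on `A` with the independence complex of `G` restricted to `W`. -/
def cx (G : SimpleGraph V) (A : Finset V) (W : Set V) : LowerSet (Finset V) where
  carrier := {s | (∀ x ∈ s, x ∈ A ∨ x ∈ W) ∧ ∀ x ∈ s, ∀ y ∈ s, x ∈ W → y ∈ W → ¬ G.Adj x y}
  lower' := fun _ _ hab ha => ⟨fun x hx => ha.1 x (hab hx),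
    fun x hx y hy => ha.2 x (hab hx) y (hab hy)⟩

lemma mem_cx {G : SimpleGraph V} {A : Finset V} {W : Set V} {s : Finset V} :
    s ∈ cx G A W ↔ (∀ x ∈ s, x ∈ A ∨ x ∈ W) ∧
      ∀ x ∈ s, ∀ y ∈ s, x ∈ W → y ∈ W → ¬ G.Adj x y := Iff.rfl

lemma empty_mem_cx {G : SimpleGraph V} {A : Finset V} {W : Set V} : ∅ ∈ cx G A W := by
  simp [mem_cx]

lemma cx_iso {G : SimpleGraph V} {A : Finset V} {W : Set V} {v : V} (hv : v ∈ W)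
    (h : ∀ w ∈ W, ¬ G.Adj v w) : cx G A W = cx G (insert v A) (W \ {v}) := by
  ext s
  simp only [SetLike.mem_coe, mem_cx, Finset.mem_insert, Set.mem_sdiff, Set.mem_singleton_iff]
  constructor
  · rintro ⟨h1, h2⟩
    refine ⟨fun x hx => ?_, fun x hx y hy hxW hyW => h2 x hx y hy hxW.1 hyW.1⟩
    have := h1 x hx
    tauto
  · rintro ⟨h1, h2⟩
    refine ⟨fun x hx => ?_, fun x hx y hy hxW hyW => ?_⟩
    · rcases h1 x hx with (rfl | h) | h
      · exact Or.inr hv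
      · exact Or.inl h
      · exact Or.inr h.1
    · by_cases hxv : x = v
      · subst hxv; exact h y hyW
      by_cases hyv : y = v
      · subst hyv; exact fun hh => h x hxW hh.symm
      exact h2 x hx y hy ⟨hxW, hxv⟩ ⟨hyW, hyv⟩

lemma cx_del {G : SimpleGraph V} {A : Finset V} {W : Set V} {v : V} (hv : v ∉ A) :
    delC v (cx G A W) = cx G A (W \ {v}) := by
  ext s
  simp only [SetLike.mem_coe, mem_delC, mem_cx, Set.mem_sdiff, Set.mem_singleton_iff]
  constructor
  · rintro ⟨⟨h1, h2⟩, h3⟩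
    refine ⟨fun x hx => ?_, fun x hx y hy hxW hyW => h2 x hx y hy hxW.1 hyW.1⟩
    have := h1 x hx
    have : x ≠ v := by rintro rfl; exact h3 hx
    tauto
  · rintro ⟨h1, h2⟩
    have h3 : v ∉ s := fun hs => by
      have := h1 v hs
      tauto
    refine ⟨⟨fun x hx => ?_, fun x hx y hy hxW hyW => ?_⟩, h3⟩
    · have := h1 x hx
      tauto
    · exact h2 x hx y hy ⟨hxW, fun h => h3 (h ▸ hx)⟩ ⟨hyW, fun h => h3 (h ▸ hy)⟩

lemma cx_star {G : SimpleGraph V} {A : Finset V} {W : Set V} {v : V} (hv : v ∈ W)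
    (hA : ∀ x ∈ A, x ∉ W) :
    starC v (cx G A W) = cx G (insert v A) (W \ {w | w = v ∨ G.Adj v w}) := by
  ext s
  simp only [SetLike.mem_coe, mem_starC, mem_cx, Finset.mem_insert, Set.mem_sdiff,
    Set.mem_ofPred_eq]
  constructor
  · rintro ⟨h1, h2⟩
    refine ⟨fun x hx => ?_, fun x hx y hy hxW hyW =>
      h2 x (Or.inr hx) y (Or.inr hy) hxW.1 hyW.1⟩
    have a1 := h1 x (Or.inr hx)
    have a2 := h2 v (Or.inl rfl) x (Or.inr hx) hv
    tauto
  · rintro ⟨h1, h2⟩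
    have key : ∀ x, x = v ∨ x ∈ s → x ∈ W → x = v ∨ (x ∈ s ∧ x ∈ W ∧ ¬ (x = v ∨ G.Adj v x)) := by
      rintro x (rfl | hx) hxW
      · exact Or.inl rfl
      · have := h1 x hx
        have := hA x
        tauto
    refine ⟨?_, fun x hx y hy hxW hyW => ?_⟩
    · rintro x (rfl | hx)
      · exact Or.inr hv
      · rcases h1 x hx with (rfl | h) | h
        · exact Or.inr hv
        · exact Or.inl h
        · exact Or.inr h.1
    · rcases key x hx hxW with rfl | hx'
      · rcases key y hy hyW with rfl | hy'
        · exact G.loopless.irrefl _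
        · tauto
      · rcases key y hy hyW with rfl | hy'
        · intro hh
          have := hh.symm
          tauto
        · exact h2 x hx'.1 y hy'.1 hx'.2 hy'.2

variable {K : Type*} [Field K]

lemma hasDepth_zero {p : LowerSet (Finset V)} (hp : ∅ ∈ p) : HasDepth K p 0 := by
  refine ⟨[], rfl, by simp, RingTheory.Sequence.IsWeaklyRegular.nil _ _, ?_⟩
  have := max_smul_lt K (srIdeal_le_max K hp)
  intro h
  have h2 := lt_of_le_of_lt (Submodule.smul_mono_left (N := ⊤) (bot_le (a := maxIdeal K V))) this
  simp at h
  have : Subsingleton (MvPolynomial V K ⧸ srIdeal K p) := by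
    exact (Submodule.subsingleton_iff (MvPolynomial V K)).1
      ((subsingleton_iff_bot_eq_top).1 (by simpa using h.symm))
  exact absurd (Subsingleton.elim _ _) h2.ne

lemma hasDepth_cone_simplex [Finite V] (G : SimpleGraph V) (A : Finset V) :
    HasDepth K (cx G A ∅) A.card := by
  induction A using Finset.induction_on with
  | empty => exact hasDepth_zero empty_mem_cx
  | insert v A hv ih =>
    rw [Finset.card_insert_of_notMem hv]
    apply HasDepth.cone K (v := v)
    · ext s
      simp [mem_starC, mem_cx]
    · convert ih using 1
      ext s
      simp only [SetLike.mem_coe, mem_delC, mem_cx, Finset.mem_insert, Set.mem_empty_iff_false,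
        or_false, false_imp_iff, implies_true, and_true]
      constructor
      · rintro ⟨h1, h2⟩ x hx
        rcases h1 x hx with rfl | h
        · exact absurd hx h2
        · exact h
      · intro h
        exact ⟨fun x hx => Or.inr (h x hx), fun h' => hv (h v h')⟩

lemma SplitTree.hasDepth [Finite V] {G : SimpleGraph V} {d : ℕ} {W : Set V}
    (h : SplitTree G d W) : ∀ A : Finset V, (∀ x ∈ A, x ∉ W) → HasDepth K (cx G A W) (d + A.card) := by
  induction h with
  | empty => intro A _; rw [zero_add]; exact hasDepth_cone_simplex G A
  | iso d W v hv h h1 ih =>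
    intro A hA
    have hvA : v ∉ A := fun h' => hA v h' hv
    rw [cx_iso hv h, add_assoc, add_comm 1, ← Finset.card_insert_of_notMem hvA]
    apply ih
    intro x hx hxW
    rcases Finset.mem_insert.1 hx with rfl | hx
    · exact hxW.2 rfl
    · exact hA x hx hxW.1
  | split d W v hv h1 h2 ih1 ih2 =>
    intro A hA
    have hvA : v ∉ A := fun h' => hA v h' hv
    apply HasDepth.split K (v := v)
    · rw [mem_cx]
      simp [hv]
    · rw [cx_del hvA]
      exact ih1 A fun x hx hxW => hA x hx hxW.1
    · rw [cx_star hv hA, add_assoc, add_comm 1, ← Finset.card_insert_of_notMem hvA]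
      apply ih2
      intro x hx hxW
      rcases Finset.mem_insert.1 hx with rfl | hx
      · exact hxW.2 (Or.inl rfl)
      · exact hA x hx hxW.1
  | weak d e W hde h ih =>
    intro A hA
    exact HasDepth.mono K empty_mem_cx (by omega) (ih A hA)

/-- Independent sets. -/
def Indep (G : SimpleGraph V) (s : Finset V) : Prop := ∀ x ∈ s, ∀ y ∈ s, ¬ G.Adj x y

lemma edgeIdeal_eq (G : SimpleGraph V) : edgeIdeal K G = srIdeal K (cx G ∅ Set.univ) := by
  have : {m : MvPolynomial V K | ∃ i j : V, G.Adj i j ∧ m = X i * X j} =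
      (fun s => monomial s (1 : K)) '' {s | ∃ i j : V, G.Adj i j ∧
        s = Finsupp.single i 1 + Finsupp.single j 1} := by
    ext m
    constructor
    · rintro ⟨i, j, h, rfl⟩
      exact ⟨_, ⟨i, j, h, rfl⟩, by simp [X, monomial_mul]⟩
    · rintro ⟨_, ⟨i, j, h, rfl⟩, rfl⟩
      exact ⟨i, j, h, by simp [X, monomial_mul]⟩
  ext f
  rw [edgeIdeal, this, mem_ideal_span_monomial_image, mem_srIdeal]
  constructor
  · intro h m hm
    by_contra hc
    obtain ⟨_, ⟨i, j, hij, rfl⟩, hle⟩ := h m (mem_support_iff.2 hc)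
    have hne : i ≠ j := hij.ne
    have hi := hle i
    have hj := hle j
    simp [Finsupp.single_apply, hne, hne.symm] at hi hj
    exact hm.2 i (by simp; omega) j (by simp; omega) trivial trivial hij
  · intro h m hm
    by_contra hc
    apply mem_support_iff.1 hm
    apply h
    rw [mem_cx]
    refine ⟨fun _ _ => Or.inr trivial, fun x hx y hy _ _ hxy => hc ?_⟩
    refine ⟨_, ⟨x, y, hxy, rfl⟩, ?_⟩
    intro z
    have hne : x ≠ y := hxy.ne
    simp only [Finsupp.mem_support_iff] at hx hy
    simp only [Finsupp.add_apply, Finsupp.single_apply]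
    split_ifs <;> subst_vars <;> first | exact absurd rfl hne | omega

lemma mem_edgeIdeal {G : SimpleGraph V} {f : MvPolynomial V K} :
    f ∈ edgeIdeal K G ↔ ∀ m : V →₀ ℕ, Indep G m.support → coeff m f = 0 := by
  rw [edgeIdeal_eq, mem_srIdeal]
  simp [mem_cx, Indep]

lemma Greedy.exists_finset {G : SimpleGraph V} {d : ℕ} {W : Set V} (h : Greedy G d W) :
    ∃ F : Finset V, (∀ x ∈ F, x ∈ W) ∧ Indep G F ∧ (∀ w ∈ W, w ∈ F ∨ ∃ x ∈ F, G.Adj x w) ∧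
      F.card ≤ d := by
  induction h with
  | empty => exact ⟨∅, by simp, by simp [Indep], by simp, by simp⟩
  | step d W v hv h ih =>
    obtain ⟨F, h1, h2, h3, h4⟩ := ih
    refine ⟨insert v F, ?_, ?_, ?_, (Finset.card_insert_le _ _).trans (by omega)⟩
    · intro x hx
      rcases Finset.mem_insert.1 hx with rfl | hx
      · exact hv
      · exact (h1 x hx).1
    · intro x hx y hy hxy
      rcases Finset.mem_insert.1 hx with rfl | hx'
      · rcases Finset.mem_insert.1 hy with rfl | hy
        · exact hxy.ne rfl
        · exact (h1 y hy).2 (Or.inr hxy)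
      · rcases Finset.mem_insert.1 hy with rfl | hy
        · exact (h1 x hx').2 (Or.inr hxy.symm)
        · exact h2 x hx' y hy hxy
    · intro w hw
      by_cases hwv : w = v ∨ G.Adj v w
      · rcases hwv with rfl | hwv
        · simp
        · exact Or.inr ⟨v, by simp, hwv⟩
      · rcases h3 w ⟨hw, hwv⟩ with h | ⟨x, hx, hxw⟩
        · exact Or.inl (by simp [h])
        · exact Or.inr ⟨x, by simp [hx], hxw⟩

end complexes

section upperBounds

variable {V : Type} [DecidableEq V] {K : Type*} [Field K]

/-- Indicator exponent vector of a finset. -/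
noncomputable def ind (F : Finset V) : V →₀ ℕ :=
  Finsupp.onFinset F (fun i => if i ∈ F then 1 else 0) (by intro a; simp)

lemma ind_apply (F : Finset V) (i : V) : ind F i = if i ∈ F then 1 else 0 := rfl

lemma ind_support (F : Finset V) : (ind F).support = F := by
  ext i
  simp [ind_apply]

/-- Coefficient functional on `S/I(G)` at a monomial with independent support. -/
noncomputable def coeffQ (G : SimpleGraph V) (m : V →₀ ℕ) (hm : Indep G m.support) :
    (MvPolynomial V K ⧸ edgeIdeal K G) →ₗ[K] K :=
  (((edgeIdeal K G).restrictScalars K).liftQ (lcoeff K m)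
    (fun f hf => by
      rw [LinearMap.mem_ker]
      exact mem_edgeIdeal.1 hf m hm)) ∘ₗ
    (Submodule.Quotient.restrictScalarsEquiv K (edgeIdeal K G)).symm.toLinearMap

lemma coeffQ_mk (G : SimpleGraph V) (m : V →₀ ℕ) (hm : Indep G m.support)
    (f : MvPolynomial V K) : coeffQ G m hm (Ideal.Quotient.mk (edgeIdeal K G) f) = coeff m f :=
  rfl

lemma monomial_mem_edgeIdeal {G : SimpleGraph V} {m : V →₀ ℕ} {x y : V}
    (hx : m x ≠ 0) (hy : m y ≠ 0) (hxy : G.Adj x y) (c : K) : monomial m c ∈ edgeIdeal K G := by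
  rw [mem_edgeIdeal]
  intro m' hm'
  rw [coeff_monomial]
  split_ifs with h
  · subst h
    exact absurd hxy (hm' x (by simpa using hx) y (by simpa using hy))
  · rfl

lemma krull_le [Finite V] (F : Finset V) (P : Ideal (MvPolynomial V K))
    (hP : ∀ v, v ∉ F → X v ∈ P) : ringKrullDim (MvPolynomial V K ⧸ P) ≤ (F.card : WithBot ℕ∞) := by
  let φ : MvPolynomial F K →ₐ[K] (MvPolynomial V K ⧸ P) :=
    aeval (fun i => Ideal.Quotient.mk P (X (i : V)))
  have hφ : Function.Surjective φ := by
    intro q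
    obtain ⟨f, rfl⟩ := Ideal.Quotient.mk_surjective q
    induction f using MvPolynomial.induction_on with
    | C a =>
      refine ⟨C a, ?_⟩
      simp only [φ, aeval_C]
      rfl
    | add p q hp hq =>
      obtain ⟨a, ha⟩ := hp
      obtain ⟨b, hb⟩ := hq
      exact ⟨a + b, by rw [map_add, map_add, ha, hb]⟩
    | mul_X p v hp =>
      obtain ⟨a, ha⟩ := hp
      by_cases hv : v ∈ F
      · refine ⟨a * X ⟨v, hv⟩, ?_⟩
        rw [map_mul, map_mul, ha]
        simp [φ]
      · refine ⟨0, ?_⟩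
        rw [map_zero, map_mul, Ideal.Quotient.eq_zero_iff_mem.2 (hP v hv), mul_zero]
  have h1 := ringKrullDim_le_of_surjective φ.toRingHom hφ
  refine h1.trans ?_
  rw [MvPolynomial.ringKrullDim_of_isNoetherianRing, ringKrullDim_eq_zero_of_field]
  simp

lemma depth_le [Finite V] (G : SimpleGraph V) (F : Finset V) (hF : Indep G F)
    (hd : ∀ w, w ∈ F ∨ ∃ x ∈ F, G.Adj x w) (rs : List (MvPolynomial V K))
    (hm : ∀ r ∈ rs, r ∈ maxIdeal K V)
    (hr : RingTheory.Sequence.IsWeaklyRegular (MvPolynomial V K ⧸ edgeIdeal K G) rs) :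
    rs.length ≤ F.card := by
  obtain ⟨P, hP, hle, hs⟩ := exists_assoc_between (maxIdeal K V)
    (Ideal.Quotient.mk (edgeIdeal K G) (monomial (ind F) 1)) (by
      intro s h0
      rw [mem_maxIdeal]
      have h1 : Ideal.Quotient.mk (edgeIdeal K G) (s * monomial (ind F) 1) = 0 := h0
      rw [Ideal.Quotient.eq_zero_iff_mem, mem_edgeIdeal] at h1
      have h2 := h1 (ind F) (by rwa [ind_support])
      rw [coeff_mul_monomial'] at h2
      simpa using h2)
  have h3 := length_le_dim (maxIdeal K V) rs hm hr P hP hle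
  have h4 := h3.trans (krull_le F P (by
    intro v hv
    apply hs
    change Ideal.Quotient.mk (edgeIdeal K G) (X v * monomial (ind F) 1) = 0
    rw [Ideal.Quotient.eq_zero_iff_mem, X, monomial_mul]
    obtain ⟨x, hx, hxv⟩ := (hd v).resolve_left hv
    refine monomial_mem_edgeIdeal (x := x) (y := v) ?_ ?_ hxv _
    · simp [ind_apply, hx]
    · simp))
  exact_mod_cast h4

lemma sdepth_le (G : SimpleGraph V) (F : Finset V) (hF : Indep G F)
    (hd : ∀ w, w ∈ F ∨ ∃ x ∈ F, G.Adj x w) (D : StanleyDecomposition (edgeIdeal K G)) (n : ℕ)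
    (hn : ∀ j, n ≤ (D.Z j).card) : n ≤ F.card := by
  have hI : Indep G (ind F).support := by rwa [ind_support]
  have key : ∃ j, ∃ a : V →₀ ℕ, a.support ⊆ D.Z j ∧ D.u j + a = ind F := by
    by_contra hc
    push Not at hc
    have htop := D.internal.submodule_iSup_eq_top
    have hle : (⨆ j, stanleySpace (edgeIdeal K G) (D.u j) (D.Z j)) ≤
        LinearMap.ker (coeffQ (K := K) G (ind F) hI) := by
      refine iSup_le fun j => ?_
      rw [stanleySpace, Submodule.span_le]
      rintro _ ⟨a, ha, rfl⟩
      rw [SetLike.mem_coe, LinearMap.mem_ker, coeffQ_mk, coeff_monomial, if_neg (hc j a ha)]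
    rw [htop] at hle
    have := hle (x := Ideal.Quotient.mk (edgeIdeal K G) (monomial (ind F) 1)) trivial
    rw [LinearMap.mem_ker, coeffQ_mk, coeff_monomial, if_pos rfl] at this
    exact one_ne_zero this
  obtain ⟨j, a, ha, hja⟩ := key
  refine (hn j).trans (Finset.card_le_card ?_)
  intro z hz
  by_contra hzF
  obtain ⟨x, hx, hxz⟩ := (hd z).resolve_left hzF
  have hsup : (a + Finsupp.single z 1).support ⊆ D.Z j := by
    refine Finsupp.support_add.trans (Finset.union_subset ha ?_)
    exact Finsupp.support_single_subset.trans (by simpa using hz)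
  apply (D.free j).ne_zero ⟨_, hsup⟩
  simp only
  rw [Ideal.Quotient.eq_zero_iff_mem, ← add_assoc, hja]
  refine monomial_mem_edgeIdeal (x := x) (y := z) ?_ ?_ hxz _
  · simp [ind_apply, hx]
  · simp

end upperBounds

section sdepthLower

variable {V : Type} [DecidableEq V] {K : Type*} [Field K]

/-- `P` partitions the faces of `p` containing `A` into intervals with tops of size at least `d`. -/
def IntervalPartition (p : LowerSet (Finset V)) (A : Finset V) (d : ℕ)
    (P : Finset (Finset V × Finset V)) : Prop :=
  (∀ q ∈ P, A ⊆ q.1 ∧ q.1 ⊆ q.2 ∧ q.2 ∈ p ∧ d ≤ q.2.card) ∧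
  ∀ t ∈ p, A ⊆ t → ∃ q ∈ P, (q.1 ⊆ t ∧ t ⊆ q.2) ∧
    ∀ q' ∈ P, q'.1 ⊆ t → t ⊆ q'.2 → q' = q

lemma SplitTree.partition {G : SimpleGraph V} {d : ℕ} {W : Set V}
    (h : SplitTree G d W) : ∀ A : Finset V, (∀ x ∈ A, x ∉ W) →
      ∃ P, IntervalPartition (cx G A W) A (d + A.card) P := by
  induction h with
  | empty =>
    intro A _
    refine ⟨{(A, A)}, ?_, ?_⟩
    · intro q hq
      obtain rfl := Finset.mem_singleton.1 hq
      refine ⟨subset_rfl, subset_rfl, ?_, by simp⟩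
      rw [mem_cx]
      exact ⟨fun x hx => Or.inl hx, fun x hx y hy h => h.elim⟩
    · intro t ht hA
      refine ⟨(A, A), by simp, ⟨hA, ?_⟩, ?_⟩
      · intro x hx
        exact (ht.1 x hx).resolve_right id
      · intro q hq _ _
        exact Finset.mem_singleton.1 hq
  | iso d W v hv h h1 ih =>
    intro A hA
    have hvA : v ∉ A := fun h' => hA v h' hv
    obtain ⟨P, hP1, hP2⟩ := ih (insert v A) (by
      intro x hx hxW
      rcases Finset.mem_insert.1 hx with rfl | hx
      · exact hxW.2 rfl
      · exact hA x hx hxW.1)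
    rw [← cx_iso hv h] at hP1 hP2
    refine ⟨P.image (fun q => (q.1.erase v, q.2)), ?_, ?_⟩
    · intro q hq
      obtain ⟨r, hr, rfl⟩ := Finset.mem_image.1 hq
      obtain ⟨a1, a2, a3, a4⟩ := hP1 r hr
      rw [Finset.card_insert_of_notMem hvA] at a4
      refine ⟨?_, (Finset.erase_subset _ _).trans a2, a3, by simp only; omega⟩
      intro x hx
      exact Finset.mem_erase.2 ⟨fun h => hvA (h ▸ hx), a1 (Finset.mem_insert_of_mem hx)⟩
    · intro t ht hAt
      have ht' : insert v t ∈ cx G A W := by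
        rw [cx_iso hv h] at ht ⊢
        rw [mem_cx] at ht ⊢
        refine ⟨?_, ?_⟩
        · intro x hx
          rcases Finset.mem_insert.1 hx with rfl | hx
          · simp
          · exact ht.1 x hx
        · intro x hx y hy hxW hyW
          rcases Finset.mem_insert.1 hx with rfl | hx'
          · exact absurd rfl hxW.2
          rcases Finset.mem_insert.1 hy with rfl | hy'
          · exact absurd rfl hyW.2
          exact ht.2 x hx' y hy' hxW hyW
      obtain ⟨q, hq, ⟨hq1, hq2⟩, hq3⟩ := hP2 (insert v t) ht' (Finset.insert_subset_insert _ hAt)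
      refine ⟨(q.1.erase v, q.2), Finset.mem_image_of_mem _ hq, ⟨?_, ?_⟩, ?_⟩
      · exact Finset.subset_insert_iff.1 hq1
      · exact (Finset.subset_insert _ _).trans hq2
      · intro q' hq' h1' h2'
        obtain ⟨r, hr, rfl⟩ := Finset.mem_image.1 hq'
        obtain ⟨a1, a2, a3, a4⟩ := hP1 r hr
        rw [hq3 r hr]
        · exact Finset.subset_insert_iff.2 h1'
        · exact Finset.insert_subset (a2 (a1 (Finset.mem_insert_self _ _))) h2'
  | split d W v hv h1 h2 ih1 ih2 =>
    intro A hA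
    have hvA : v ∉ A := fun h' => hA v h' hv
    obtain ⟨P, hP1, hP2⟩ := ih1 A fun x hx hxW => hA x hx hxW.1
    obtain ⟨Q, hQ1, hQ2⟩ := ih2 (insert v A) (by
      intro x hx hxW
      rcases Finset.mem_insert.1 hx with rfl | hx
      · exact hxW.2 (Or.inl rfl)
      · exact hA x hx hxW.1)
    rw [← cx_del hvA] at hP1 hP2
    rw [← cx_star hv hA] at hQ1 hQ2
    refine ⟨P ∪ Q, ?_, ?_⟩
    · intro q hq
      rcases Finset.mem_union.1 hq with hq | hq
      · obtain ⟨a1, a2, a3, a4⟩ := hP1 q hq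
        exact ⟨a1, a2, a3.1, a4⟩
      · obtain ⟨a1, a2, a3, a4⟩ := hQ1 q hq
        rw [Finset.card_insert_of_notMem hvA] at a4
        exact ⟨(Finset.subset_insert _ _).trans a1, a2,
          (cx G A W).lower (Finset.subset_insert _ _) a3, by omega⟩
    · intro t ht hAt
      by_cases hvt : v ∈ t
      · obtain ⟨q, hq, hq1, hq2⟩ := hQ2 t (by rwa [mem_starC, Finset.insert_eq_of_mem hvt])
          (Finset.insert_subset hvt hAt)
        refine ⟨q, Finset.mem_union_right _ hq, hq1, ?_⟩
        intro q' hq' b1 b2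
        rcases Finset.mem_union.1 hq' with hq' | hq'
        · exact absurd (b2 hvt) (hP1 q' hq').2.2.1.2
        · exact hq2 q' hq' b1 b2
      · obtain ⟨q, hq, hq1, hq2⟩ := hP2 t ⟨ht, hvt⟩ hAt
        refine ⟨q, Finset.mem_union_left _ hq, hq1, ?_⟩
        intro q' hq' b1 b2
        rcases Finset.mem_union.1 hq' with hq' | hq'
        · exact hq2 q' hq' b1 b2
        · exact absurd (b1 ((hQ1 q' hq').1 (Finset.mem_insert_self _ _))) hvt
  | weak d e W hde h ih =>
    intro A hA
    obtain ⟨P, hP1, hP2⟩ := ih A hA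
    refine ⟨P, fun q hq => ?_, hP2⟩
    obtain ⟨a1, a2, a3, a4⟩ := hP1 q hq
    exact ⟨a1, a2, a3, by omega⟩

/-- The monomial basis of `S/I(G)`. -/
noncomputable def bas (K : Type*) [Field K] (G : SimpleGraph V)
    (m : {m : V →₀ ℕ // Indep G m.support}) : MvPolynomial V K ⧸ edgeIdeal K G :=
  Ideal.Quotient.mk (edgeIdeal K G) (monomial m.1 1)

lemma bas_linearIndependent (G : SimpleGraph V) : LinearIndependent K (bas K G) := by
  rw [linearIndependent_iff']
  intro s g hg i hi
  have := congrArg (coeffQ (K := K) G i.1 i.2) hg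
  rw [map_sum, map_zero, Finset.sum_eq_single i] at this
  · rw [map_smul, bas, coeffQ_mk, coeff_monomial, if_pos rfl] at this
    simpa using this
  · intro j _ hj
    rw [map_smul, bas, coeffQ_mk, coeff_monomial, if_neg (fun h => hj (Subtype.ext h)), smul_zero]
  · exact fun h => absurd hi h

lemma Indep.subset {G : SimpleGraph V} {s t : Finset V} (h : Indep G t) (hst : s ⊆ t) :
    Indep G s := fun x hx y hy => h x (hst hx) y (hst hy)

lemma supp_ind_add {A B : Finset V} (hAB : A ⊆ B) {a : V →₀ ℕ} (ha : a.support ⊆ B) :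
    A ⊆ (ind A + a).support ∧ (ind A + a).support ⊆ B := by
  constructor
  · intro i hi
    simp [ind_apply, hi]
  · refine Finsupp.support_add.trans (Finset.union_subset ?_ ha)
    rwa [ind_support]

lemma stanley_eq (G : SimpleGraph V) {A B : Finset V} (hAB : A ⊆ B) (hB : Indep G B) :
    stanleySpace (edgeIdeal K G) (ind A) B =
      Submodule.span K (bas K G '' {m | A ⊆ m.1.support ∧ m.1.support ⊆ B}) := by
  rw [stanleySpace]
  congr 1
  ext x
  constructor
  · rintro ⟨a, ha, rfl⟩
    have := supp_ind_add hAB ha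
    exact ⟨⟨ind A + a, hB.subset this.2⟩, this, rfl⟩
  · rintro ⟨m, ⟨h1, h2⟩, rfl⟩
    have hle : ind A ≤ m.1 := by
      intro i
      rw [ind_apply]
      split_ifs with hi
      · exact Nat.one_le_iff_ne_zero.2 (Finsupp.mem_support_iff.1 (h1 hi))
      · exact Nat.zero_le _
    refine ⟨m.1 - ind A, ?_, ?_⟩
    · intro i hi
      apply h2
      simp only [Finsupp.mem_support_iff, Finsupp.tsub_apply] at hi ⊢
      omega
    · rw [bas, add_tsub_cancel_of_le hle]

lemma exists_stanley (G : SimpleGraph V) {d : ℕ} (h : SplitTree G d Set.univ) :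
    ∃ D : StanleyDecomposition (edgeIdeal K G), ∀ j, d ≤ (D.Z j).card := by
  obtain ⟨P, hP1, hP2⟩ := h.partition ∅ (by simp)
  have hcx : ∀ t, t ∈ cx G ∅ Set.univ ↔ Indep G t := by
    intro t
    simp [mem_cx, Indep]
  let e := P.equivFin.symm
  let T : Fin P.card → Set {m : V →₀ ℕ // Indep G m.support} := fun j =>
    {m | (e j).1.1 ⊆ m.1.support ∧ m.1.support ⊆ (e j).1.2}
  have hB : ∀ j, Indep G (e j).1.2 := fun j => (hcx _).1 (hP1 _ (e j).2).2.2.1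
  have hAB : ∀ j, (e j).1.1 ⊆ (e j).1.2 := fun j => (hP1 _ (e j).2).2.1
  have hS : ∀ j, stanleySpace (edgeIdeal K G) (ind (e j).1.1) (e j).1.2 =
      Submodule.span K (bas K G '' T j) := fun j => stanley_eq G (hAB j) (hB j)
  have hli := bas_linearIndependent (K := K) G
  refine ⟨⟨P.card, fun j => ind (e j).1.1, fun j => (e j).1.2, ?_, ?_⟩, ?_⟩
  · intro j
    refine hli.comp (fun a : {a : V →₀ ℕ // a.support ⊆ (e j).1.2} =>
      ⟨ind (e j).1.1 + a.1, (hB j).subset (supp_ind_add (hAB j) a.2).2⟩) ?_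
    intro a b hab
    exact Subtype.ext (add_left_cancel (congrArg Subtype.val hab))
  · rw [DirectSum.isInternal_submodule_iff_iSupIndep_and_iSup_eq_top]
    simp only [hS]
    constructor
    · intro j
      simp only [← Submodule.span_iUnion, ← Set.image_iUnion]
      apply hli.disjoint_span_image
      rw [Set.disjoint_left]
      intro m hm hm'
      simp only [Set.mem_iUnion] at hm'
      obtain ⟨i, hij, hmi⟩ := hm'
      obtain ⟨q, hq, _, hq2⟩ := hP2 m.1.support ((hcx _).2 m.2) (by simp)
      apply hij
      apply e.injective
      apply Subtype.ext
      rw [hq2 _ (e i).2 hmi.1 hmi.2, hq2 _ (e j).2 hm.1 hm.2]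
    · rw [eq_top_iff]
      rintro x -
      obtain ⟨f, rfl⟩ := Ideal.Quotient.mk_surjective x
      induction f using MvPolynomial.induction_on' with
      | monomial m c =>
        by_cases hm : Indep G m.support
        · obtain ⟨q, hq, hq1, _⟩ := hP2 m.support ((hcx _).2 hm) (by simp)
          have h1 : Ideal.Quotient.mk (edgeIdeal K G) (monomial m c) = c • bas K G ⟨m, hm⟩ := by
            have : monomial m c = c • monomial m (1 : K) := by simp [smul_monomial]
            rw [this]
            rfl
          rw [h1]
          refine Submodule.smul_mem _ _ ?_
          refine Submodule.mem_iSup_of_mem (e.symm ⟨q, hq⟩) (Submodule.subset_span ?_)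
          refine Set.mem_image_of_mem _ ?_
          change (e (e.symm ⟨q, hq⟩)).1.1 ⊆ _ ∧ _ ⊆ (e (e.symm ⟨q, hq⟩)).1.2
          rw [Equiv.apply_symm_apply]
          exact hq1
        · have : Ideal.Quotient.mk (edgeIdeal K G) (monomial m c) = 0 := by
            rw [Ideal.Quotient.eq_zero_iff_mem]
            unfold Indep at hm
            push Not at hm
            obtain ⟨x, hx, y, hy, hxy⟩ := hm
            exact monomial_mem_edgeIdeal (by simpa using hx) (by simpa using hy) hxy c
          rw [this]
          exact Submodule.zero_mem _
      | add p q hp hq =>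
        rw [map_add]
        exact Submodule.add_mem _ hp hq
  · intro j
    have := (hP1 _ (e j).2).2.2.2
    simpa using this

end sdepthLower

lemma graphC_values (n : ℕ) (K : Type*) [Field K] :
    depthQuot (edgeIdeal K (graphC n)) = 2 * ((n + 2) / 4) + 1 ∧
    sdepthQuot (edgeIdeal K (graphC n)) = 2 * ((n + 2) / 4) + 1 := by
  obtain ⟨hT, hG⟩ := (ladder_main (n := n) n).1 le_rfl
  rw [ladder_univ] at hT hG
  obtain ⟨F, -, hF1, hF2, hF3⟩ := hG.exists_finset
  have hd : ∀ w, w ∈ F ∨ ∃ x ∈ F, (graphC n).Adj x w := fun w => hF2 w trivial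
  constructor
  · refine IsGreatest.csSup_eq ⟨?_, ?_⟩
    · have := hT.hasDepth (K := K) ∅ (by simp)
      rw [HasDepth, ← edgeIdeal_eq, Finset.card_empty, add_zero] at this
      exact this
    · rintro m ⟨rs, rfl, hm, hr⟩
      exact (depth_le (graphC n) F hF1 hd rs hm hr.toIsWeaklyRegular).trans hF3
  · refine IsGreatest.csSup_eq ⟨?_, ?_⟩
    · exact exists_stanley _ hT
    · rintro m ⟨D, hD⟩
      exact (sdepth_le (graphC n) F hF1 hd D m hD).trans hF3

theorem depth_sdepth_graphC (n : ℕ) (hn : 2 ≤ n) (K : Type*) [Field K] :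
    depthQuot (edgeIdeal K (graphC n)) = sdepthQuot (edgeIdeal K (graphC n)) ∧
    ((n % 4 = 0 ∨ n % 4 = 3) → depthQuot (edgeIdeal K (graphC n)) = ⌈(n : ℚ) / 2⌉₊ + 1) ∧
    (n % 4 = 1 → depthQuot (edgeIdeal K (graphC n)) = ⌈((n : ℚ) + 1) / 2⌉₊) ∧
    (n % 4 = 2 → depthQuot (edgeIdeal K (graphC n)) = ⌈((n : ℚ) + 1) / 2⌉₊ + 1) := by
  obtain ⟨h1, h2⟩ := graphC_values n K
  have key : ∀ a b : ℕ, a ≤ 2 * b → 2 * b ≤ a + 1 → ⌈(a : ℚ) / 2⌉₊ = b := by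
    intro a b h3 h4
    apply le_antisymm
    · rw [Nat.ceil_le, div_le_iff₀ (by norm_num)]
      have : (a : ℚ) ≤ 2 * b := by exact_mod_cast h3
      linarith
    · by_contra hc
      push Not at hc
      have h5 := Nat.le_ceil ((a : ℚ) / 2)
      rw [div_le_iff₀ (by norm_num)] at h5
      have h6 : a ≤ ⌈(a : ℚ) / 2⌉₊ * 2 := by exact_mod_cast h5
      omega
  have key' : ∀ b : ℕ, n + 1 ≤ 2 * b → 2 * b ≤ n + 2 → ⌈((n : ℚ) + 1) / 2⌉₊ = b := by
    intro b h3 h4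
    have := key (n + 1) b h3 h4
    push_cast at this
    exact this
  rw [h1, h2]
  refine ⟨rfl, fun h => ?_, fun h => ?_, fun h => ?_⟩
  · rw [key n (2 * ((n + 2) / 4)) (by omega) (by omega)]
  · rw [key' (2 * ((n + 2) / 4) + 1) (by omega) (by omega)]
  · rw [key' (2 * ((n + 2) / 4)) (by omega) (by omega)]
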